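/- Let W_5 ⊆ {0,1}^3 be the configuration consisting of a vertex of Q_3 together with two of its neighbors, e.g. W_5 = {(0,0,0),(1,0,0),(0,1,0)}. Then λ(W_5,3) ≥ 1/3. -/

import Mathlib

open Filter

namespace CubeDensity

/-- The automorphism of `Q_d` given by permuting coordinates by `σ` and then
complementing the values in the coordinates where `ε` is `true`. -/
def autMap (d : ℕ) (σ : Equiv.Perm (Fin d)) (ε : Fin d → Bool) (v : Fin d → Bool) :
    Fin d → Bool :=
  fun i => xor (v (σ⁻¹ i)) (ε i)

/-- `K` is an exact copy of `H` in `Q_d`: some automorphism of `Q_d` maps `H` onto `K`. -/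
def ExactCopy (d : ℕ) (H K : Set (Fin d → Bool)) : Prop :=
  ∃ σ : Equiv.Perm (Fin d), ∃ ε : Fin d → Bool, autMap d σ ε '' H = K

/-- The vertex of `Q_n` in the sub-`d`-cube with flip coordinates `F` (and fixed values `g`
outside `F`) corresponding to the vertex `u` of `Q_d`, identifying the flip coordinates
with `Fin d` in increasing order. -/
def embed {n d : ℕ} (F : Finset (Fin n)) (hF : F.card = d) (g : Fin n → Bool)
    (u : Fin d → Bool) : Fin n → Bool :=
  fun i => if h : i ∈ F then u ((F.orderIsoOfFin hF).symm ⟨i, h⟩) else g i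

/-- The sub-`d`-cube of `Q_n` with flip coordinates `F` and fixed values `g` outside `F`
is `H`-good for `S`: the configuration induced by `S` on it is an exact copy of `H`. -/
def IsGood {n d : ℕ} (H : Set (Fin d → Bool)) (S : Set (Fin n → Bool))
    (F : Finset (Fin n)) (hF : F.card = d) (g : Fin n → Bool) : Prop :=
  ExactCopy d H {u : Fin d → Bool | embed F hF g u ∈ S}

/-- The number of `H`-good sub-`d`-cubes of `Q_n`, where a sub-`d`-cube is encoded as a
pair `(F, g)` with `F` the `d`-element set of flip coordinates and `g` the fixed values
outside `F` (normalized to be `false` on `F`). -/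
noncomputable def goodCount (d : ℕ) (H : Set (Fin d → Bool)) (n : ℕ)
    (S : Set (Fin n → Bool)) : ℕ :=
  Nat.card {p : Finset (Fin n) × (Fin n → Bool) //
    ∃ hF : p.1.card = d, (∀ i ∈ p.1, p.2 i = false) ∧ IsGood H S p.1 hF p.2}

/-- `g(H,d,n,S)`: the fraction of the `C(n,d) * 2^(n-d)` sub-`d`-cubes of `Q_n` that are
`H`-good for `S`. -/
noncomputable def gFrac (d : ℕ) (H : Set (Fin d → Bool)) (n : ℕ)
    (S : Set (Fin n → Bool)) : ℝ :=
  (goodCount d H n S : ℝ) / ((n.choose d : ℝ) * 2 ^ (n - d))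

/-- `ex(H,d,n)`: the maximum over all `S ⊆ {0,1}^n` of the fraction of `H`-good
sub-`d`-cubes. -/
noncomputable def exD (d : ℕ) (H : Set (Fin d → Bool)) (n : ℕ) : ℝ :=
  ⨆ S : Set (Fin n → Bool), gFrac d H n S


open Classical in
/-- Encoded sub-3-cubes. -/
noncomputable def cubes (n : ℕ) : Finset (Finset (Fin n) × (Fin n → Bool)) :=
  Finset.univ.filter fun p => p.1.card = 3 ∧ ∀ i ∈ p.1, p.2 i = false

/-- Good encoded cubes. -/
def Gd (H : Set (Fin 3 → Bool)) {n : ℕ} (S : Set (Fin n → Bool))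
    (p : Finset (Fin n) × (Fin n → Bool)) : Prop :=
  ∃ hF : p.1.card = 3, (∀ i ∈ p.1, p.2 i = false) ∧ IsGood H S p.1 hF p.2

open Classical in
lemma goodCount_eq (H : Set (Fin 3 → Bool)) (n : ℕ) (S : Set (Fin n → Bool)) :
    goodCount 3 H n S = ∑ p : Finset (Fin n) × (Fin n → Bool), if Gd H S p then 1 else 0 := by
  unfold goodCount
  rw [Nat.card_eq_fintype_card, Fintype.card_subtype, Finset.card_filter]
  refine Finset.sum_congr rfl fun p _ => ?_
  by_cases h : Gd H S p
  · rw [if_pos h]; exact if_pos h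
  · rw [if_neg h]; exact if_neg h

open Classical in
lemma card_vanish {n : ℕ} (F : Finset (Fin n)) (b : Bool) :
    (Finset.univ.filter fun g : Fin n → Bool => ∀ i ∈ F, g i = b).card = 2 ^ (n - F.card) := by
  have : (Finset.univ.filter fun g : Fin n → Bool => ∀ i ∈ F, g i = b)
      = Fintype.piFinset (fun i => if i ∈ F then {b} else Finset.univ) := by
    ext g
    simp only [Finset.mem_filter, Finset.mem_univ, true_and, Fintype.mem_piFinset]
    refine forall_congr' fun i => ?_
    by_cases h : i ∈ F <;> simp [h]
  rw [this, Fintype.card_piFinset]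
  have h2 : ∀ i : Fin n, ((if i ∈ F then {b} else Finset.univ : Finset Bool)).card
      = if i ∈ F then 1 else 2 := by
    intro i; split_ifs <;> simp
  simp_rw [h2]
  rw [Finset.prod_ite]
  simp [Finset.filter_not, Finset.card_sdiff]

open Classical in
lemma card_cubes (n : ℕ) : (cubes n).card = n.choose 3 * 2 ^ (n - 3) := by
  unfold cubes
  rw [Finset.card_filter, Fintype.sum_prod_type]
  have : ∀ F : Finset (Fin n), (∑ g : Fin n → Bool,
      if (F.card = 3 ∧ ∀ i ∈ F, g i = false) then 1 else 0)
      = if F.card = 3 then 2 ^ (n - 3) else 0 := by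
    intro F
    by_cases h : F.card = 3
    · have := card_vanish F false
      rw [h, Finset.card_filter] at this
      simpa [h] using this
    · simp [h]
  simp_rw [this]
  rw [← Finset.sum_filter, Finset.sum_const, smul_eq_mul]
  congr 1
  have : (Finset.univ.filter fun F : Finset (Fin n) => F.card = 3)
      = Finset.powersetCard 3 Finset.univ := by
    ext F; simp [Finset.mem_powersetCard]
  rw [this, Finset.card_powersetCard]; simp

lemma embed_eq {n d : ℕ} (F : Finset (Fin n)) (hF : F.card = d) (g : Fin n → Bool)
    (u : Fin d → Bool) (w : Fin n → Bool)
    (h1 : ∀ k, w (F.orderEmbOfFin hF k) = u k) (h2 : ∀ i, i ∉ F → w i = g i) :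
    embed F hF g u = w := by
  funext i
  unfold embed
  split_ifs with h
  · rw [← h1]
    congr 1
    rw [← Finset.coe_orderIsoOfFin_apply]
    simp
  · exact (h2 i h).symm

lemma embed_at {n d : ℕ} (F : Finset (Fin n)) (hF : F.card = d) (g : Fin n → Bool)
    (u : Fin d → Bool) (k : Fin d) : embed F hF g u (F.orderEmbOfFin hF k) = u k := by
  unfold embed
  rw [dif_pos (Finset.orderEmbOfFin_mem F hF k)]
  congr 1
  rw [OrderIso.symm_apply_eq]
  ext
  simp

lemma embed_off {n d : ℕ} (F : Finset (Fin n)) (hF : F.card = d) (g : Fin n → Bool)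
    (u : Fin d → Bool) (i : Fin n) (h : i ∉ F) : embed F hF g u i = g i := by
  simp [embed, h]

lemma goodCount_le (H : Set (Fin 3 → Bool)) (n : ℕ) (S : Set (Fin n → Bool)) :
    (goodCount 3 H n S : ℝ) ≤ exD 3 H n * ((n.choose 3 : ℝ) * 2 ^ (n - 3)) ∨ n < 3 := by
  by_cases hn : n < 3
  · exact Or.inr hn
  left
  push Not at hn
  have hD : (0 : ℝ) < (n.choose 3 : ℝ) * 2 ^ (n - 3) := by
    have := Nat.choose_pos hn
    positivity
  rw [← div_le_iff₀ hD]
  exact le_ciSup (f := fun S => gFrac 3 H n S) (Set.finite_range _).bddAbove S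

open Classical in
lemma facet (H : Set (Fin 3 → Bool)) (n : ℕ) (S : Set (Fin (n + 1) → Bool))
    (i : Fin (n + 1)) (p : Finset (Fin (n + 1)) × (Fin (n + 1) → Bool)) (hi : i ∉ p.1)
    (hp : Gd H S p) :
    Gd H {x | (i.insertNth (p.2 i) x : Fin (n + 1) → Bool) ∈ S}
      (Finset.univ.filter (fun j => i.succAbove j ∈ p.1), fun j => p.2 (i.succAbove j)) := by
  obtain ⟨F, g⟩ := p
  obtain ⟨hF, hv, hg⟩ := hp
  simp only at hF hv hg hi ⊢
  set F' : Finset (Fin n) := Finset.univ.filter (fun j => i.succAbove j ∈ F) with hF'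
  have hmap : F'.map i.succAboveEmb = F := by
    ext j
    simp only [Finset.mem_map, hF', Finset.mem_filter, Finset.mem_univ, true_and,
      Fin.coe_succAboveEmb]
    constructor
    · rintro ⟨a, h, rfl⟩; exact h
    · intro h
      rcases Fin.eq_self_or_eq_succAbove i j with rfl | ⟨a, rfl⟩
      · exact absurd h hi
      · exact ⟨a, h, rfl⟩
  have hc : F'.card = 3 := by rw [← hF, ← hmap, Finset.card_map]
  refine ⟨hc, fun j hj => hv _ (by simpa [hF'] using hj), ?_⟩
  unfold IsGood at hg ⊢
  convert hg using 1
  ext u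
  simp only [Set.mem_ofPred_eq]
  have hord : ∀ k, F.orderEmbOfFin hF k = i.succAbove (F'.orderEmbOfFin hc k) := by
    intro k
    have := Finset.orderEmbOfFin_unique hF (f := fun k => i.succAbove (F'.orderEmbOfFin hc k))
      (fun k => by
        have := Finset.orderEmbOfFin_mem F' hc k
        exact (Finset.mem_filter.mp this).2)
      ((Fin.strictMono_succAbove i).comp (F'.orderEmbOfFin hc).strictMono)
    exact (congrFun this k).symm
  rw [embed_eq F hF g u (i.insertNth (g i) (embed F' hc (fun j => g (i.succAbove j)) u))]
  · intro k
    rw [hord, Fin.insertNth_apply_succAbove, embed_at]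
  · intro j hj
    rcases Fin.eq_self_or_eq_succAbove i j with rfl | ⟨a, rfl⟩
    · simp
    · rw [Fin.insertNth_apply_succAbove, embed_off]
      simpa [hF'] using hj

open Classical in
lemma count_ineq (H : Set (Fin 3 → Bool)) (n : ℕ) (S : Set (Fin (n + 1) → Bool)) :
    (n + 1 - 3) * goodCount 3 H (n + 1) S ≤
      ∑ q : Fin (n + 1) × Bool,
        goodCount 3 H n {x | (q.1.insertNth q.2 x : Fin (n + 1) → Bool) ∈ S} := by
  have h1 : (n + 1 - 3) * goodCount 3 H (n + 1) S =
      (Finset.univ.filter fun z : Fin (n + 1) × (Finset (Fin (n + 1)) × (Fin (n + 1) → Bool)) =>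
        z.1 ∉ z.2.1 ∧ Gd H S z.2).card := by
    rw [goodCount_eq, Finset.card_filter, Finset.mul_sum]
    refine Eq.trans ?_ (Fintype.sum_prod_type_right _).symm
    refine Finset.sum_congr rfl fun p _ => ?_
    by_cases hp : Gd H S p
    · simp only [hp, and_true, if_true, mul_one]
      rw [← Finset.card_filter, Finset.filter_not, Finset.card_sdiff]
      simp [hp.1]
    · simp [hp]
  have h2 : ∑ q : Fin (n + 1) × Bool,
        goodCount 3 H n {x | (q.1.insertNth q.2 x : Fin (n + 1) → Bool) ∈ S} =
      (Finset.univ.filter fun z : (Fin (n + 1) × Bool) × (Finset (Fin n) × (Fin n → Bool)) =>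
        Gd H {x | (z.1.1.insertNth z.1.2 x : Fin (n + 1) → Bool) ∈ S} z.2).card := by
    simp_rw [goodCount_eq]
    rw [Finset.card_filter]
    symm
    exact Fintype.sum_prod_type _
  rw [h1, h2]
  refine Finset.card_le_card_of_injOn (fun z => ((z.1, z.2.2 z.1),
    (Finset.univ.filter (fun j => z.1.succAbove j ∈ z.2.1), fun j => z.2.2 (z.1.succAbove j))))
    ?_ ?_
  · intro z hz
    simp only [Finset.coe_filter, Finset.mem_univ, true_and, Set.mem_ofPred_eq] at hz ⊢
    exact facet H n S z.1 z.2 hz.1 hz.2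
  · rintro ⟨i, F, g⟩ hz ⟨i', F', g'⟩ hz' h
    simp only [Finset.coe_filter, Finset.mem_univ, true_and, Set.mem_ofPred_eq] at hz hz'
    simp only [Prod.mk.injEq] at h
    obtain ⟨⟨rfl, hb⟩, hFF, hgg⟩ := h
    have e1 : F = F' := by
      ext j
      rcases Fin.eq_self_or_eq_succAbove i j with rfl | ⟨a, rfl⟩
      · simp [hz.1, hz'.1]
      · simpa using Finset.ext_iff.mp hFF a
    have e2 : g = g' := by
      funext j
      rcases Fin.eq_self_or_eq_succAbove i j with rfl | ⟨a, rfl⟩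
      · exact hb
      · exact congrFun hgg a
    rw [e1, e2]

lemma exD_succ_le (H : Set (Fin 3 → Bool)) (n : ℕ) (hn : 3 ≤ n) :
    exD 3 H (n + 1) ≤ exD 3 H n := by
  refine ciSup_le fun S => ?_
  unfold gFrac
  have hD : (0 : ℝ) < (((n + 1).choose 3 : ℕ) : ℝ) * 2 ^ (n + 1 - 3) := by
    have := Nat.choose_pos (show 3 ≤ n + 1 by omega)
    positivity
  rw [div_le_iff₀ hD]
  have h := count_ineq H n S
  have h' : ((n + 1 - 3 : ℕ) : ℝ) * goodCount 3 H (n + 1) S ≤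
      ∑ q : Fin (n + 1) × Bool, exD 3 H n * ((n.choose 3 : ℝ) * 2 ^ (n - 3)) := by
    refine le_trans (by exact_mod_cast h) (b := ((∑ q : Fin (n + 1) × Bool,
        goodCount 3 H n {x | (q.1.insertNth q.2 x : Fin (n + 1) → Bool) ∈ S} : ℕ) : ℝ)) ?_
    push_cast
    refine Finset.sum_le_sum fun q _ => ?_
    exact (goodCount_le H n _).resolve_right (by omega)
  rw [Finset.sum_const, nsmul_eq_mul] at h'
  simp only [Finset.card_univ, Fintype.card_prod, Fintype.card_fin, Fintype.card_bool] at h'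
  obtain ⟨m, rfl⟩ : ∃ m, n = m + 3 := ⟨n - 3, by omega⟩
  have hch : ((m + 3 : ℕ) + 1 : ℝ) * ((m + 3).choose 3 : ℝ) =
      ((m + 3 + 1).choose 3 : ℝ) * (m + 1) := by
    have h2 := Nat.choose_mul_succ_eq (m + 3) 3
    have h3 : m + 3 + 1 - 3 = m + 1 := by omega
    rw [h3] at h2
    have : ((m + 3).choose 3 * (m + 3 + 1) : ℝ) = (m + 3 + 1).choose 3 * (m + 1) := by
      exact_mod_cast h2
    push_cast
    linarith
  have e1 : m + 3 + 1 - 3 = m + 1 := by omega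
  have e2 : m + 3 - 3 = m := by omega
  rw [e1, e2] at h'
  rw [e1]
  have hm : (0 : ℝ) < ((m + 1 : ℕ) : ℝ) := by positivity
  refine le_of_mul_le_mul_left (h'.trans (le_of_eq ?_)) hm
  push_cast at hch ⊢
  rw [pow_succ]
  linear_combination (exD 3 H (m + 3) * 2 ^ m * 2) * hch

/-- The target configuration. -/
abbrev W5 : Set (Fin 3 → Bool) :=
  {![false, false, false], ![true, false, false], ![false, true, false]}

/-- weight mod 3 of `x` on the coordinates coloured `b`. -/
def wt {n : ℕ} (c : Fin n → Bool) (b : Bool) (x : Fin n → Bool) : ZMod 3 :=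
  ∑ i, if c i = b ∧ x i = true then 1 else 0

/-- The construction. -/
def SS {n : ℕ} (c : Fin n → Bool) (q : ZMod 3 × ZMod 3) : Set (Fin n → Bool) :=
  {x | q.1 + wt c false x ≠ 0 ∧ q.2 + wt c true x ≠ 0}

lemma wt_embed {n : ℕ} (c : Fin n → Bool) (b : Bool) (F : Finset (Fin n)) (hF : F.card = 3)
    (g : Fin n → Bool) (hg : ∀ i ∈ F, g i = false) (u : Fin 3 → Bool) :
    wt c b (embed F hF g u) = wt c b g + wt (fun k => c (F.orderEmbOfFin hF k)) b u := by
  have key : ∀ x : Fin n → Bool, wt c b x =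
      (∑ i ∈ Fᶜ, if c i = b ∧ x i = true then 1 else 0)
      + ∑ k : Fin 3, if c (F.orderEmbOfFin hF k) = b ∧ x (F.orderEmbOfFin hF k) = true
        then 1 else 0 := by
    intro x
    unfold wt
    rw [← Finset.sum_compl_add_sum F]
    congr 1
    conv_lhs => rw [← Finset.map_orderEmbOfFin_univ F hF]
    rw [Finset.sum_map]
    rfl
  rw [key, key g]
  have h0 : (∑ k : Fin 3, if c (F.orderEmbOfFin hF k) = b ∧ g (F.orderEmbOfFin hF k) = true
        then (1 : ZMod 3) else 0) = 0 := by
    refine Finset.sum_eq_zero fun k _ => ?_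
    simp [hg _ (Finset.orderEmbOfFin_mem F hF k)]
  rw [h0, add_zero]
  congr 1
  · refine Finset.sum_congr rfl fun i hi => ?_
    rw [embed_off _ _ _ _ _ (by simpa using hi)]
  · simp_rw [embed_at]
    rfl

/-- Decidable sufficient check. -/
def Chk (c : Fin 3 → Bool) (q : ZMod 3 × ZMod 3) : Prop :=
  ∃ k : Fin 3, ∃ ε : Fin 3 → Bool, ∀ u : Fin 3 → Bool,
    ((xor (u (Equiv.swap 2 k 2)) (ε (Equiv.swap 2 k 2)) = false) ∧
      ¬ (xor (u (Equiv.swap 2 k 0)) (ε (Equiv.swap 2 k 0)) = true ∧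
        xor (u (Equiv.swap 2 k 1)) (ε (Equiv.swap 2 k 1)) = true)) ↔
    (q.1 + wt c false u ≠ 0 ∧ q.2 + wt c true u ≠ 0)

instance (c : Fin 3 → Bool) (q : ZMod 3 × ZMod 3) : Decidable (Chk c q) := by
  unfold Chk; infer_instance

lemma chk_count : ∀ c : Fin 3 → Bool, (¬ ∀ k, c k = false) → (¬ ∀ k, c k = true) →
    4 ≤ (Finset.univ.filter fun q : ZMod 3 × ZMod 3 => Chk c q).card := by
  decide +kernel

lemma mem_W5 (v : Fin 3 → Bool) : v ∈ W5 ↔ (v 2 = false ∧ ¬ (v 0 = true ∧ v 1 = true)) := by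
  have : ∀ v : Fin 3 → Bool, (v = ![false, false, false] ∨ v = ![true, false, false] ∨
    v = ![false, true, false]) ↔ (v 2 = false ∧ ¬ (v 0 = true ∧ v 1 = true)) := by decide
  exact this v

lemma chk_copy (c : Fin 3 → Bool) (q : ZMod 3 × ZMod 3) (h : Chk c q) :
    ExactCopy 3 W5 (SS c q) := by
  obtain ⟨k, ε, h⟩ := h
  refine ⟨Equiv.swap 2 k, ε, ?_⟩
  ext u
  have h2 : u ∈ autMap 3 (Equiv.swap 2 k) ε '' W5 ↔
      (fun i => xor (u (Equiv.swap 2 k i)) (ε (Equiv.swap 2 k i))) ∈ W5 := by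
    constructor
    · rintro ⟨v, hv, rfl⟩
      convert hv using 1
      funext i
      simp [autMap]
    · intro hu
      refine ⟨_, hu, ?_⟩
      funext i
      simp [autMap]
  rw [h2, mem_W5]
  exact h u

lemma good_of_chk {n : ℕ} (c : Fin n → Bool) (q : ZMod 3 × ZMod 3) (F : Finset (Fin n))
    (hF : F.card = 3) (g : Fin n → Bool) (hg : ∀ i ∈ F, g i = false)
    (h : Chk (fun k => c (F.orderEmbOfFin hF k)) (q + (wt c false g, wt c true g))) :
    Gd W5 (SS c q) (F, g) := by
  refine ⟨hF, hg, ?_⟩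
  have := chk_copy _ _ h
  unfold IsGood
  convert this using 1
  ext u
  simp only [SS, Set.mem_ofPred_eq, wt_embed c _ F hF g hg u, Prod.fst_add, Prod.snd_add, add_assoc]

open Classical in
lemma count_q {n : ℕ} (c : Fin n → Bool) (F : Finset (Fin n))
    (hF : F.card = 3) (g : Fin n → Bool) (hg : ∀ i ∈ F, g i = false)
    (h0 : ¬ ∀ i ∈ F, c i = false) (h1 : ¬ ∀ i ∈ F, c i = true) :
    4 ≤ ∑ q : ZMod 3 × ZMod 3, if Gd W5 (SS c q) (F, g) then 1 else 0 := by
  have tr : ∀ b, (∀ k, c (F.orderEmbOfFin hF k) = b) → ∀ i ∈ F, c i = b := by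
    intro b hb i hi
    have : i ∈ Set.range (F.orderEmbOfFin hF) := by rw [Finset.range_orderEmbOfFin]; exact hi
    obtain ⟨k, rfl⟩ := this
    exact hb k
  have := chk_count (fun k => c (F.orderEmbOfFin hF k)) (fun h => h0 (tr _ h))
    (fun h => h1 (tr _ h))
  rw [Finset.card_filter,
    ← Equiv.sum_comp (Equiv.addRight ((wt c false g, wt c true g) : ZMod 3 × ZMod 3))] at this
  refine this.trans (Finset.sum_le_sum fun q _ => ?_)
  by_cases a : Chk (fun k => c (F.orderEmbOfFin hF k))
    (Equiv.addRight ((wt c false g, wt c true g) : ZMod 3 × ZMod 3) q)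
  · rw [if_pos (good_of_chk c q F hF g hg a), if_pos a]
  · rw [if_neg a]; exact Nat.zero_le _

open Classical in
lemma count_c {n : ℕ} (F : Finset (Fin n)) (hF : F.card = 3) :
    3 * 2 ^ n ≤ 4 * (Finset.univ.filter fun c : Fin n → Bool =>
      ¬ (∀ i ∈ F, c i = false) ∧ ¬ ∀ i ∈ F, c i = true).card := by
  have hn : 3 ≤ n := by
    have := Finset.card_le_univ F
    simpa [hF] using this
  have a := card_vanish F false
  have b := card_vanish F true
  rw [hF] at a b
  have hu : (Finset.univ : Finset (Fin n → Bool)) ⊆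
      ((Finset.univ.filter fun g : Fin n → Bool => ∀ i ∈ F, g i = false) ∪
      (Finset.univ.filter fun g : Fin n → Bool => ∀ i ∈ F, g i = true)) ∪
      (Finset.univ.filter fun c : Fin n → Bool =>
      ¬ (∀ i ∈ F, c i = false) ∧ ¬ ∀ i ∈ F, c i = true) := by
    intro c _
    simp only [Finset.mem_union, Finset.mem_filter, Finset.mem_univ, true_and]
    tauto
  have h1 := Finset.card_le_card hu
  have h2 := h1.trans (Finset.card_union_le _ _)
  have h3 := Finset.card_union_le
    (Finset.univ.filter fun g : Fin n → Bool => ∀ i ∈ F, g i = false)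
    (Finset.univ.filter fun g : Fin n → Bool => ∀ i ∈ F, g i = true)
  rw [a, b] at h3
  have hc : (Finset.univ : Finset (Fin n → Bool)).card = 2 ^ n := by simp
  rw [hc] at h2
  obtain ⟨m, rfl⟩ : ∃ m, n = m + 3 := ⟨n - 3, by omega⟩
  have e2 : m + 3 - 3 = m := by omega
  rw [e2] at h3
  rw [pow_add] at h2 ⊢
  omega

open Classical in
lemma total (n : ℕ) :
    3 * 2 ^ n * (n.choose 3 * 2 ^ (n - 3)) ≤
      ∑ z : (Fin n → Bool) × (ZMod 3 × ZMod 3), goodCount 3 W5 n (SS z.1 z.2) := by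
  simp_rw [goodCount_eq]
  rw [Finset.sum_comm, ← card_cubes, mul_comm, ← smul_eq_mul, ← Finset.sum_const]
  refine le_trans (Finset.sum_le_sum (fun p hp => ?_))
    (Finset.sum_le_sum_of_subset (Finset.subset_univ (cubes n)))
  obtain ⟨F, g⟩ := p
  simp only [cubes, Finset.mem_filter, Finset.mem_univ, true_and] at hp
  refine (count_c F hp.1).trans ?_
  rw [Fintype.sum_prod_type, Finset.card_filter, Finset.mul_sum]
  refine Finset.sum_le_sum fun c _ => ?_
  split_ifs with h
  · exact count_q c F hp.1 g hp.2 h.1 h.2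
  · simp

lemma third_le (n : ℕ) (hn : 3 ≤ n) : 1 / 3 ≤ exD 3 W5 n := by
  have hD : (0 : ℝ) < (n.choose 3 : ℝ) * 2 ^ (n - 3) := by
    have := Nat.choose_pos hn
    positivity
  have h := total n
  have h' : (3 * 2 ^ n * (n.choose 3 * 2 ^ (n - 3)) : ℝ) ≤
      ∑ z : (Fin n → Bool) × (ZMod 3 × ZMod 3),
        exD 3 W5 n * ((n.choose 3 : ℝ) * 2 ^ (n - 3)) := by
    refine le_trans (by exact_mod_cast h) (b := ((∑ z : (Fin n → Bool) × (ZMod 3 × ZMod 3),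
      goodCount 3 W5 n (SS z.1 z.2) : ℕ) : ℝ)) ?_
    push_cast
    refine Finset.sum_le_sum fun q _ => ?_
    exact (goodCount_le W5 n _).resolve_right (by omega)
  rw [Finset.sum_const, nsmul_eq_mul] at h'
  simp only [Finset.card_univ, Fintype.card_prod, Fintype.card_pi, Fintype.card_bool,
    ZMod.card, Finset.prod_const, Fintype.card_fin] at h'
  push_cast at h'
  have h2 : (0 : ℝ) < 2 ^ n * ((n.choose 3 : ℝ) * 2 ^ (n - 3)) := by positivity
  refine le_of_mul_le_mul_right ?_ h2
  linarith

end CubeDensity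

/-- λ(W₅, 3) ≥ 1/3, where W₅ = {(0,0,0),(1,0,0),(0,1,0)} consists of a vertex of Q₃
together with two of its neighbors. -/
theorem dCubeDensity_W5_ge :
    ∃ L : ℝ,
      Filter.Tendsto
        (fun n => CubeDensity.exD 3
          ({![false, false, false], ![true, false, false],
            ![false, true, false]} : Set (Fin 3 → Bool)) n)
        Filter.atTop (nhds L) ∧ 1 / 3 ≤ L := by
  have hanti : Antitone (fun n => CubeDensity.exD 3 CubeDensity.W5 (n + 3)) :=
    antitone_nat_of_succ_le fun n => CubeDensity.exD_succ_le _ (n + 3) (by omega)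
  have hlb : ∀ n, (1 : ℝ) / 3 ≤ CubeDensity.exD 3 CubeDensity.W5 (n + 3) :=
    fun n => CubeDensity.third_le (n + 3) (by omega)
  refine ⟨⨅ n, CubeDensity.exD 3 CubeDensity.W5 (n + 3), ?_, le_ciInf hlb⟩
  rw [← Filter.tendsto_add_atTop_iff_nat 3]
  exact tendsto_atTop_ciInf hanti ⟨1 / 3, by rintro _ ⟨n, rfl⟩; exact hlb n⟩
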